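/- (Hessian coefficient error for BQNL.) Let η : ℤ → [0,1] be N-periodic with α_ξ := 1 − (η_ξ + η_{ξ−1})/2 and β_ξ := η_ξ, let y ∈ 𝒴 with min_ξ y'_ξ > 0, and set C̄_i := C_i(2 min_ξ y'_ξ). Then max_ξ |Ā_ξ − A_ξ| ≤ 2εC̄₃ max_ξ |Δβ_ξ · y''_ξ| + 2ε² ( C̄₃ max_ξ |(1−β_{ξ−1}) y'''_ξ| + C̄₄ max_ξ |(1−β_ξ)(y''_ξ)²| ). -/

import Mathlib

open scoped BigOperators ENNReal
open Finset

noncomputable section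

/-- The lattice spacing `ε = 1/N`. -/
def eps (N : ℕ) : ℝ := (N : ℝ)⁻¹

/-- `u : ℤ → ℝ` is `N`-periodic. -/
def IsPeriodic (N : ℕ) (u : ℤ → ℝ) : Prop := ∀ ξ : ℤ, u (ξ + N) = u ξ

/-- Membership in the space `𝒰` of `N`-periodic mean-zero displacements. -/
def inU (N : ℕ) (u : ℤ → ℝ) : Prop :=
  IsPeriodic N u ∧ ∑ ξ ∈ Finset.Icc (1 : ℤ) (N : ℤ), u ξ = 0

/-- The uniform deformation `y^F_ξ = F ε ξ`. -/
def yUnif (N : ℕ) (F : ℝ) : ℤ → ℝ := fun ξ => F * eps N * ξ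

/-- Membership in the space `𝒴` of admissible deformations. -/
def inY (N : ℕ) (y : ℤ → ℝ) : Prop :=
  ∃ F : ℝ, 0 < F ∧ ∃ u : ℤ → ℝ, inU N u ∧ y = fun ξ => yUnif N F ξ + u ξ

/-- The discrete first derivative `y'_ξ = (y_ξ - y_{ξ-1})/ε`. -/
def d1 (N : ℕ) (y : ℤ → ℝ) (ξ : ℤ) : ℝ := (y ξ - y (ξ - 1)) / eps N

/-- The discrete second derivative `y''_ξ`. -/
def d2 (N : ℕ) (y : ℤ → ℝ) (ξ : ℤ) : ℝ :=
  (y (ξ + 1) - 2 * y ξ + y (ξ - 1)) / (eps N) ^ 2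

/-- The discrete third derivative `y'''_ξ`. -/
def d3 (N : ℕ) (y : ℤ → ℝ) (ξ : ℤ) : ℝ :=
  (y (ξ + 1) - 3 * y ξ + 3 * y (ξ - 1) - y (ξ - 2)) / (eps N) ^ 3

/-- The BQC energy `Φ_{α,β}`. -/
def PhiBQC (N : ℕ) (φ : ℝ → ℝ) (α β : ℤ → ℝ) (y : ℤ → ℝ) : ℝ :=
  eps N * ∑ ξ ∈ Finset.Icc (1 : ℤ) (N : ℤ),
    (φ (d1 N y ξ) + α ξ * φ (2 * d1 N y ξ) + β ξ * φ (d1 N y ξ + d1 N y (ξ + 1)))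

/-- The BQNL energy with blending function `η`. -/
def PhiBQNL (N : ℕ) (φ : ℝ → ℝ) (η : ℤ → ℝ) : (ℤ → ℝ) → ℝ :=
  PhiBQC N φ (fun ξ => 1 - (η ξ + η (ξ - 1)) / 2) η

/-- The BQCE energy with blending function `γ`. -/
def PhiBQCE (N : ℕ) (φ : ℝ → ℝ) (γ : ℤ → ℝ) : (ℤ → ℝ) → ℝ :=
  PhiBQC N φ (fun ξ => (γ ξ + γ (ξ - 1)) / 2) (fun ξ => 1 - (γ (ξ + 1) + γ (ξ - 1)) / 2)

/-- The atomistic energy `Φ`. -/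
def PhiAt (N : ℕ) (φ : ℝ → ℝ) (y : ℤ → ℝ) : ℝ :=
  eps N * ∑ ξ ∈ Finset.Icc (1 : ℤ) (N : ℤ),
    (φ (d1 N y ξ) + φ (d1 N y ξ + d1 N y (ξ + 1)))

/-- The first variation `δΨ(y)[u] = (d/dt)|_{t=0} Ψ(y+tu)`. -/
def fvar (Ψ : (ℤ → ℝ) → ℝ) (y u : ℤ → ℝ) : ℝ :=
  deriv (fun t : ℝ => Ψ (fun ξ => y ξ + t * u ξ)) 0

/-- The second variation `δ²Ψ(y)[u,u] = (d²/dt²)|_{t=0} Ψ(y+tu)`. -/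
def svar (Ψ : (ℤ → ℝ) → ℝ) (y u : ℤ → ℝ) : ℝ :=
  iteratedDeriv 2 (fun t : ℝ => Ψ (fun ξ => y ξ + t * u ξ)) 0

/-- `max_ξ |v_ξ|` (for a periodic sequence this is a genuine maximum). -/
def supAbs (v : ℤ → ℝ) : ℝ := sSup (Set.range fun ξ => |v ξ|)

/-- `min_ξ y'_ξ` (for an admissible deformation this is a genuine minimum). -/
def infD1 (N : ℕ) (y : ℤ → ℝ) : ℝ := sInf (Set.range fun ξ => d1 N y ξ)

/-- The constant `C_i(r₀) = sup_{r ≥ r₀} |φ^(i)(r)|`. -/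
def Cbound (φ : ℝ → ℝ) (i : ℕ) (r₀ : ℝ) : ℝ :=
  sSup ((fun r => |iteratedDeriv i φ r|) '' Set.Ici r₀)

/-- The `ℓ^p_ε` norm over one period, `p ∈ [1,∞]`. -/
def lpnorm (N : ℕ) (p : ℝ≥0∞) (v : ℤ → ℝ) : ℝ :=
  if p = ⊤ then supAbs v
  else (eps N * ∑ ξ ∈ Finset.Icc (1 : ℤ) (N : ℤ), |v ξ| ^ p.toReal) ^ (1 / p.toReal)

/-- The Hessian coefficient `A_ξ` of the atomistic energy. -/
def Acoef (N : ℕ) (φ : ℝ → ℝ) (y : ℤ → ℝ) (ξ : ℤ) : ℝ :=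
  iteratedDeriv 2 φ (d1 N y ξ) + 2 * iteratedDeriv 2 φ (d1 N y ξ + d1 N y (ξ + 1))
    + 2 * iteratedDeriv 2 φ (d1 N y (ξ - 1) + d1 N y ξ)

/-- The Hessian coefficient `Ā_ξ` of the BQC energy. -/
def AbarCoef (N : ℕ) (φ : ℝ → ℝ) (α β : ℤ → ℝ) (y : ℤ → ℝ) (ξ : ℤ) : ℝ :=
  iteratedDeriv 2 φ (d1 N y ξ) + 2 * β ξ * iteratedDeriv 2 φ (d1 N y ξ + d1 N y (ξ + 1))
    + 2 * β (ξ - 1) * iteratedDeriv 2 φ (d1 N y (ξ - 1) + d1 N y ξ)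
    + 4 * α ξ * iteratedDeriv 2 φ (2 * d1 N y ξ)

/-- The coercivity constant `inf { δ²Ψ(y)[u,u] : u ∈ 𝒰, ‖u'‖_{ℓ²_ε} = 1 }`. -/
def coercConst (N : ℕ) (Ψ : (ℤ → ℝ) → ℝ) (y : ℤ → ℝ) : ℝ :=
  sInf { c : ℝ | ∃ u : ℤ → ℝ, inU N u ∧ lpnorm N 2 (d1 N u) = 1 ∧ c = svar Ψ y u }

end

/-- A periodic sequence is bounded by the supremum of its absolute values. -/
lemma IsPeriodic.abs_le_supAbs {N : ℕ} (hN : 0 < N) {f : ℤ → ℝ} (hf : IsPeriodic N f) (ξ : ℤ) :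
    |f ξ| ≤ supAbs f := by
  have hper : Function.Periodic f (N : ℤ) := hf
  have hfin : (Set.range fun ζ => |f ζ|).Finite := by
    refine ((Set.finite_Icc (0 : ℤ) N).image fun ζ => |f ζ|).subset ?_
    rintro _ ⟨ζ, rfl⟩
    have hpos : (0 : ℤ) < N := by exact_mod_cast hN
    refine ⟨ζ % N, ⟨Int.emod_nonneg _ hpos.ne', (Int.emod_lt_of_pos _ hpos).le⟩, ?_⟩
    simp only [Int.emod_def, mul_comm (N : ℤ)]
    exact congrArg _ (hper.sub_int_mul_eq (ζ / N))
  exact le_csSup hfin.bddAbove ⟨ξ, rfl⟩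

lemma IsPeriodic.sub_one {N : ℕ} {f : ℤ → ℝ} (hf : IsPeriodic N f) :
    IsPeriodic N fun ξ => f (ξ - 1) := fun ξ => by
  simpa only [add_sub_right_comm] using hf (ξ - 1)

lemma eps_pos {N : ℕ} (hN : 0 < N) : 0 < eps N := by
  unfold eps; positivity

lemma inY.add_period {N : ℕ} {y : ℤ → ℝ} (hy : inY N y) :
    ∃ c : ℝ, ∀ ξ : ℤ, y (ξ + N) = y ξ + c := by
  obtain ⟨F, -, u, ⟨hu, -⟩, rfl⟩ := hy
  refine ⟨F * eps N * N, fun ξ => ?_⟩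
  simp only [yUnif, hu ξ]
  push_cast
  ring

lemma inY.isPeriodic_d2 {N : ℕ} {y : ℤ → ℝ} (hy : inY N y) : IsPeriodic N (d2 N y) := by
  obtain ⟨c, hc⟩ := hy.add_period
  intro ξ
  simp only [d2, add_right_comm ξ (N : ℤ) 1, add_sub_right_comm ξ (N : ℤ) 1, hc]
  ring

lemma inY.isPeriodic_d3 {N : ℕ} {y : ℤ → ℝ} (hy : inY N y) : IsPeriodic N (d3 N y) := by
  obtain ⟨c, hc⟩ := hy.add_period
  intro ξ
  simp only [d3, add_right_comm ξ (N : ℤ) 1, add_sub_right_comm ξ (N : ℤ), hc]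
  ring

lemma d1_add_one {N : ℕ} (hN : 0 < N) (y : ℤ → ℝ) (ξ : ℤ) :
    d1 N y (ξ + 1) = d1 N y ξ + eps N * d2 N y ξ := by
  have := (eps_pos hN).ne'
  simp only [d1, d2, add_sub_cancel_right]
  field_simp
  ring

lemma d2_sub_one {N : ℕ} (hN : 0 < N) (y : ℤ → ℝ) (ξ : ℤ) :
    d2 N y (ξ - 1) = d2 N y ξ - eps N * d3 N y ξ := by
  have := (eps_pos hN).ne'
  simp only [d2, d3, sub_add_cancel, sub_sub, Int.reduceAdd]
  field_simp
  ring

/-- The infimum of `y'` is a lower bound as soon as it is positive. -/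
lemma infD1_le {N : ℕ} {y : ℤ → ℝ} (h : 0 < infD1 N y) (ξ : ℤ) : infD1 N y ≤ d1 N y ξ := by
  have hb : BddBelow (Set.range fun ζ => d1 N y ζ) := by
    by_contra hb
    exact h.ne' (Real.sInf_of_not_bddBelow hb)
  exact csInf_le hb ⟨ξ, rfl⟩

lemma abs_iteratedDeriv_le_Cbound {φ : ℝ → ℝ} {i : ℕ} {r₀ r : ℝ}
    (hb : BddAbove ((fun r => |iteratedDeriv i φ r|) '' Set.Ici r₀)) (hr : r₀ ≤ r) :
    |iteratedDeriv i φ r| ≤ Cbound φ i r₀ :=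
  le_csSup hb ⟨r, hr, rfl⟩

lemma ContDiffOn.hasDerivAt_iteratedDeriv {φ : ℝ → ℝ} {s : Set ℝ} {n : WithTop ℕ∞} {i : ℕ} {x : ℝ}
    (hφ : ContDiffOn ℝ n φ s) (hs : s ∈ nhds x) (hi : (i : WithTop ℕ∞) < n) :
    HasDerivAt (iteratedDeriv i φ) (iteratedDeriv (i + 1) φ x) x := by
  rw [iteratedDeriv_succ]
  have h := ((hφ.contDiffAt hs).contDiffWithinAt (s := Set.univ)
    ).differentiableWithinAt_iteratedDerivWithin hi (by simp)
  rw [iteratedDerivWithin_univ, differentiableWithinAt_univ] at h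
  exact h.hasDerivAt

/-- First-order Taylor expansion on a convex set with bounded second derivative. -/
lemma Convex.abs_taylor_one_remainder_le {s : Set ℝ} (hs : Convex ℝ s) {g g' g'' : ℝ → ℝ} {C : ℝ}
    (hg : ∀ x ∈ s, HasDerivAt g (g' x) x) (hg' : ∀ x ∈ s, HasDerivAt g' (g'' x) x)
    (hC : ∀ x ∈ s, |g'' x| ≤ C) {z h : ℝ} (hz : z ∈ s) (hzh : z + h ∈ s) :
    |g (z + h) - g z - g' z * h| ≤ C * h ^ 2 / 2 := by
  have hmem : ∀ t ∈ Set.Icc (0 : ℝ) 1, z + t * h ∈ s := fun t ht => by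
    simpa using hs.add_smul_mem hz hzh ht
  have hf : ∀ t ∈ Set.Icc (0 : ℝ) 1,
      HasDerivAt (fun t => g (z + t * h) - g z - g' z * (t * h))
        (g' (z + t * h) * h - g' z * h) t := fun t ht => by
    have hl : HasDerivAt (fun t : ℝ => t * h) h t := by
      simpa using (hasDerivAt_id t).mul_const h
    exact (((hg _ (hmem t ht)).comp t (hl.const_add z)).sub_const _).sub (hl.const_mul (g' z))
  have hB : ∀ t : ℝ, HasDerivAt (fun t => C * h ^ 2 / 2 * t ^ 2) (C * h ^ 2 * t) t := fun t =>
    ((hasDerivAt_pow 2 t).const_mul (C * h ^ 2 / 2)).congr_deriv (by norm_num; ring)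
  have key := image_norm_le_of_norm_deriv_right_le_deriv_boundary
    (fun t ht => (hf t ht).continuousAt.continuousWithinAt)
    (fun t ht => (hf t (Set.Ico_subset_Icc_self ht)).hasDerivWithinAt) (by simp) hB
    (fun t ht => ?_) (Set.right_mem_Icc.2 zero_le_one)
  · simpa [Real.norm_eq_abs] using key
  · have hlip := hs.norm_image_sub_le_of_norm_hasDerivWithin_le
      (fun x hx => (hg' x hx).hasDerivWithinAt) hC hz (hmem t (Set.Ico_subset_Icc_self ht))
    rw [← sub_mul, norm_mul]
    calc ‖g' (z + t * h) - g' z‖ * ‖h‖ ≤ C * ‖z + t * h - z‖ * ‖h‖ := by gcongr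
      _ = C * h ^ 2 * t := by
        rw [add_sub_cancel_left, norm_mul, Real.norm_of_nonneg ht.1, ← sq_abs h,
          Real.norm_eq_abs]
        ring

/-- Hessian coefficient error for BQNL. -/
theorem hessian_coef_error_bqnl
    (N : ℕ) (hN : 5 ≤ N) (φ : ℝ → ℝ) (hφ : ContDiffOn ℝ 4 φ (Set.Ioi 0))
    (hC : ∀ i ≤ 4, ∀ r₀ : ℝ, 0 < r₀ →
      BddAbove ((fun r => |iteratedDeriv i φ r|) '' Set.Ici r₀))
    (η : ℤ → ℝ) (hηper : IsPeriodic N η) (hη01 : ∀ ξ, η ξ ∈ Set.Icc (0 : ℝ) 1)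
    (α β : ℤ → ℝ) (hα : α = fun ξ => 1 - (η ξ + η (ξ - 1)) / 2) (hβ : β = η)
    (y : ℤ → ℝ) (hy : inY N y) (hy' : 0 < infD1 N y) :
    supAbs (fun ξ => AbarCoef N φ α β y ξ - Acoef N φ y ξ) ≤
      2 * eps N * Cbound φ 3 (2 * infD1 N y) *
          supAbs (fun ξ => (β ξ - β (ξ - 1)) * d2 N y ξ)
        + 2 * (eps N) ^ 2 *
            (Cbound φ 3 (2 * infD1 N y) * supAbs (fun ξ => (1 - β (ξ - 1)) * d3 N y ξ)
              + Cbound φ 4 (2 * infD1 N y) *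
                  supAbs (fun ξ => (1 - β ξ) * (d2 N y ξ) ^ 2)) := by
  subst hα hβ
  have hN0 : 0 < N := by omega
  have hε := eps_pos hN0
  set m := infD1 N y with hm
  set C₃ := Cbound φ 3 (2 * m)
  set C₄ := Cbound φ 4 (2 * m)
  have hnhds : ∀ x ∈ Set.Ici (2 * m), Set.Ioi (0 : ℝ) ∈ nhds x := fun x hx =>
    Ioi_mem_nhds (lt_of_lt_of_le (by linarith) hx)
  have taylor : ∀ {z h : ℝ}, z ∈ Set.Ici (2 * m) → z + h ∈ Set.Ici (2 * m) →
      |iteratedDeriv 2 φ (z + h) - iteratedDeriv 2 φ z - iteratedDeriv 3 φ z * h|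
        ≤ C₄ * h ^ 2 / 2 :=
    (convex_Ici (2 * m)).abs_taylor_one_remainder_le
      (fun x hx => hφ.hasDerivAt_iteratedDeriv (hnhds x hx) (by norm_num))
      (fun x hx => hφ.hasDerivAt_iteratedDeriv (hnhds x hx) (by norm_num))
      (fun x hx => abs_iteratedDeriv_le_Cbound (hC 4 le_rfl _ (by linarith)) hx)
  refine csSup_le (Set.range_nonempty _) ?_
  rintro _ ⟨ξ, rfl⟩
  have hd2 := hy.isPeriodic_d2
  have hΔ := IsPeriodic.abs_le_supAbs hN0
    (f := fun ξ => (β ξ - β (ξ - 1)) * d2 N y ξ)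
    (fun ζ => by simp only [hηper ζ, hηper.sub_one ζ, hd2 ζ]) ξ
  have hthird := IsPeriodic.abs_le_supAbs hN0
    (f := fun ξ => (1 - β (ξ - 1)) * d3 N y ξ)
    (fun ζ => by simp only [hηper.sub_one ζ, hy.isPeriodic_d3 ζ]) ξ
  have hsq := IsPeriodic.abs_le_supAbs hN0
    (f := fun ξ => (1 - β ξ) * (d2 N y ξ) ^ 2)
    (fun ζ => by simp only [hηper ζ, hd2 ζ])
  have hsq₀ := (le_abs_self _).trans (hsq ξ)
  have hsq₁ := (le_abs_self _).trans (hsq (ξ - 1))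
  set S₁ := supAbs fun ξ => (β ξ - β (ξ - 1)) * d2 N y ξ
  set S₂ := supAbs fun ξ => (1 - β (ξ - 1)) * d3 N y ξ
  set S₃ := supAbs fun ξ => (1 - β ξ) * (d2 N y ξ) ^ 2
  have hnext := d1_add_one hN0 y ξ
  have hprev := d1_add_one hN0 y (ξ - 1)
  rw [sub_add_cancel] at hprev
  have hm₀ := infD1_le hy' ξ
  have hm₁ := infD1_le hy' (ξ + 1)
  have hm₂ := infD1_le hy' (ξ - 1)
  rw [← hm] at hm₀ hm₁ hm₂
  have hd3 := d2_sub_one hN0 y ξ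
  have hb₀ := sub_nonneg.2 (hη01 ξ).2
  have hb₁ := sub_nonneg.2 (hη01 (ξ - 1)).2
  have hz : 2 * d1 N y ξ ∈ Set.Ici (2 * m) := Set.mem_Ici.2 (by linarith)
  have hR₀ := taylor (h := eps N * d2 N y ξ) hz (Set.mem_Ici.2 (by linarith))
  have hR₁ := taylor (h := -(eps N * d2 N y (ξ - 1))) hz (Set.mem_Ici.2 (by linarith))
  have hC₃ : |iteratedDeriv 3 φ (2 * d1 N y ξ)| ≤ C₃ :=
    abs_iteratedDeriv_le_Cbound (hC 3 (by norm_num) _ (by linarith)) hz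
  have hC₄ : 0 ≤ C₄ :=
    (abs_nonneg _).trans (abs_iteratedDeriv_le_Cbound (hC 4 le_rfl _ (by linarith)) hz)
  have e₀ : d1 N y ξ + d1 N y (ξ + 1) = 2 * d1 N y ξ + eps N * d2 N y ξ := by linarith
  have e₁ : d1 N y (ξ - 1) + d1 N y ξ = 2 * d1 N y ξ + -(eps N * d2 N y (ξ - 1)) := by linarith
  set R₀ := iteratedDeriv 2 φ (2 * d1 N y ξ + eps N * d2 N y ξ) - iteratedDeriv 2 φ (2 * d1 N y ξ)
    - iteratedDeriv 3 φ (2 * d1 N y ξ) * (eps N * d2 N y ξ) with hR₀_def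
  set R₁ := iteratedDeriv 2 φ (2 * d1 N y ξ + -(eps N * d2 N y (ξ - 1)))
    - iteratedDeriv 2 φ (2 * d1 N y ξ)
    - iteratedDeriv 3 φ (2 * d1 N y ξ) * -(eps N * d2 N y (ξ - 1)) with hR₁_def
  set D := iteratedDeriv 3 φ (2 * d1 N y ξ)
  have expand : AbarCoef N φ (fun ξ => 1 - (β ξ + β (ξ - 1)) / 2) β y ξ - Acoef N φ y ξ =
      2 * eps N * (D * ((β ξ - β (ξ - 1)) * d2 N y ξ))
      - 2 * eps N ^ 2 * (D * ((1 - β (ξ - 1)) * d3 N y ξ))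
      - 2 * ((1 - β ξ) * R₀ + (1 - β (ξ - 1)) * R₁) := by
    simp only [AbarCoef, Acoef, e₀, e₁, hR₀_def, hR₁_def]
    linear_combination 2 * eps N * D * (1 - β (ξ - 1)) * hd3
  have hterm₁ : |D * ((β ξ - β (ξ - 1)) * d2 N y ξ)| ≤ C₃ * S₁ := by
    rw [abs_mul]
    exact mul_le_mul hC₃ hΔ (abs_nonneg _) ((abs_nonneg _).trans hC₃)
  have hterm₂ : |D * ((1 - β (ξ - 1)) * d3 N y ξ)| ≤ C₃ * S₂ := by
    rw [abs_mul]
    exact mul_le_mul hC₃ hthird (abs_nonneg _) ((abs_nonneg _).trans hC₃)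
  have remainder : ∀ {b p R : ℝ}, 0 ≤ b → b * p ^ 2 ≤ S₃ → |R| ≤ C₄ * (eps N * p) ^ 2 / 2 →
      |b * R| ≤ eps N ^ 2 * (C₄ * S₃) / 2 := fun {b p R} hb hp hR => by
    rw [abs_mul, abs_of_nonneg hb]
    calc b * |R| ≤ b * (C₄ * (eps N * p) ^ 2 / 2) := by gcongr
      _ = eps N ^ 2 * (C₄ * (b * p ^ 2)) / 2 := by ring
      _ ≤ _ := by gcongr
  have hrem₀ := remainder hb₀ hsq₀ hR₀
  have hrem₁ := remainder hb₁ hsq₁ (by simpa only [neg_sq] using hR₁)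
  simp only [expand]
  rw [abs_le] at hterm₁ hterm₂ hrem₀ hrem₁ ⊢
  have h₁ := mul_le_mul_of_nonneg_left hterm₁.1 (by positivity : 0 ≤ 2 * eps N)
  have h₁' := mul_le_mul_of_nonneg_left hterm₁.2 (by positivity : 0 ≤ 2 * eps N)
  have h₂ := mul_le_mul_of_nonneg_left hterm₂.1 (by positivity : 0 ≤ 2 * eps N ^ 2)
  have h₂' := mul_le_mul_of_nonneg_left hterm₂.2 (by positivity : 0 ≤ 2 * eps N ^ 2)
  constructor <;> linarith [hrem₀.1, hrem₀.2, hrem₁.1, hrem₁.2]
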